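/- Let R be a commutative ring and S a regular multiplicative subset of R such that the localization R_S is a semisimple ring. Then every S-divisible R-module admits an S-strongly flat cover if and only if R is an S-Matlis ring, i.e., the projective dimension of R_S as an R-module is at most 1. -/

import Mathlib

/-- `Ext¹_R(A, B) = 0`, phrased via the standard characterization:
every short exact sequence `0 → B → X → A → 0` of `R`-modules splits. -/
def Ext1Vanishes (R : Type) [CommRing R] (A : Type) [AddCommGroup A] [Module R A]
    (B : Type) [AddCommGroup B] [Module R B] : Prop :=
  ∀ (X : Type) [AddCommGroup X] [Module R X] (i : B →ₗ[R] X) (p : X →ₗ[R] A),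
    Function.Injective i → Function.Surjective p → LinearMap.range i = LinearMap.ker p →
      ∃ s : A →ₗ[R] X, p ∘ₗ s = LinearMap.id

/-- An `R`-module `N` is `S`-weakly cotorsion if `Ext¹_R(R_S, N) = 0`. -/
def SWeaklyCotorsion (R : Type) [CommRing R] (S : Submonoid R)
    (N : Type) [AddCommGroup N] [Module R N] : Prop :=
  Ext1Vanishes R (Localization S) N

/-- An `R`-module `F` is `S`-strongly flat if `Ext¹_R(F, N) = 0` for every
`S`-weakly cotorsion `R`-module `N`. -/
def SStronglyFlat (R : Type) [CommRing R] (S : Submonoid R)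
    (F : Type) [AddCommGroup F] [Module R F] : Prop :=
  ∀ (N : Type) [AddCommGroup N] [Module R N], SWeaklyCotorsion R S N → Ext1Vanishes R F N

/-- An `R`-module `M` is `S`-divisible if `sM = M` for every `s ∈ S`. -/
def SDivisible (R : Type) [CommRing R] (S : Submonoid R)
    (M : Type) [AddCommGroup M] [Module R M] : Prop :=
  ∀ s ∈ S, ∀ m : M, ∃ n : M, s • n = m

/-- An `R`-module `M` is `S`-`h`-divisible if `M` is the sum of the images of all
`R`-linear maps `R_S → M`. -/
def SHDivisible (R : Type) [CommRing R] (S : Submonoid R)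
    (M : Type) [AddCommGroup M] [Module R M] : Prop :=
  (⨆ f : Localization S →ₗ[R] M, LinearMap.range f) = ⊤

/-- An `R`-module `M` is `S`-injective if for every ideal `I` of `R` meeting `S`, every
`R`-linear map `I → M` extends to `R` (equivalently, `Ext¹_R(R/I, M) = 0` for such `I`). -/
def SInjective (R : Type) [CommRing R] (S : Submonoid R)
    (M : Type) [AddCommGroup M] [Module R M] : Prop :=
  ∀ I : Ideal R, ((I : Set R) ∩ (S : Set R)).Nonempty →
    ∀ f : I →ₗ[R] M, ∃ g : R →ₗ[R] M, ∀ x : I, g (x : R) = f x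

/-- An `R`-module `T` is `S`-torsion if each of its elements is annihilated by some `s ∈ S`. -/
def STorsion (R : Type) [CommRing R] (S : Submonoid R)
    (T : Type) [AddCommGroup T] [Module R T] : Prop :=
  ∀ t : T, ∃ s ∈ S, s • t = 0

/-- `R` is an `S`-Matlis ring: the projective dimension of `R_S` as an `R`-module is at
most `1`, i.e. `R_S` is the quotient of a projective `R`-module by a projective submodule. -/
def SMatlis (R : Type) [CommRing R] (S : Submonoid R) : Prop :=
  ∃ (P : Type) (_ : AddCommGroup P) (_ : Module R P) (f : P →ₗ[R] Localization S),
    Module.Projective R P ∧ Function.Surjective f ∧ Module.Projective R (LinearMap.ker f)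

section Extensions

variable {R : Type} [CommRing R]

theorem LinearMap.exists_comp_eq {U V W : Type} [AddCommGroup U] [AddCommMonoid V]
    [AddCommMonoid W] [Module R U] [Module R V] [Module R W] {a : U →ₗ[R] V}
    (ha : Function.Surjective a) {b : U →ₗ[R] W} (hab : ∀ x, a x = 0 → b x = 0) :
    ∃ c : V →ₗ[R] W, c ∘ₗ a = b := by
  have hb : ∀ x y, a x = a y → b x = b y := fun x y hxy => by
    have h : a (x - y) = 0 := by
      rw [sub_eq_add_neg, map_add, hxy, ← map_add, add_neg_cancel, map_zero]
    rw [← sub_add_cancel x y, map_add, hab _ h, zero_add]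
  have ha' := Function.surjInv_eq ha
  exact ⟨
    { toFun := fun v => b (Function.surjInv ha v)
      map_add' := fun v w => by rw [← map_add]; exact hb _ _ (by rw [map_add, ha', ha', ha'])
      map_smul' := fun r v => by
        rw [RingHom.id_apply, ← map_smul]; exact hb _ _ (by rw [map_smul, ha', ha']) },
    LinearMap.ext fun x => hb _ _ (ha' _)⟩

variable {A B U X Y : Type} [AddCommGroup A] [AddCommGroup B] [AddCommGroup U] [AddCommGroup X]
  [AddCommGroup Y] [Module R A] [Module R B] [Module R U] [Module R X] [Module R Y]

/-- If `Ext¹(A, B) = 0`, maps out of `A` lift along an epimorphism with kernel `B`. -/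
theorem Ext1Vanishes.exists_lift (hAB : Ext1Vanishes R A B) {i : B →ₗ[R] X} {p : X →ₗ[R] Y}
    (hi : Function.Injective i) (hp : Function.Surjective p)
    (hip : LinearMap.range i = LinearMap.ker p) (h : A →ₗ[R] Y) :
    ∃ h' : A →ₗ[R] X, p ∘ₗ h' = h := by
  let E : Submodule R (A × X) :=
    LinearMap.eqLocus (h ∘ₗ LinearMap.fst R A X) (p ∘ₗ LinearMap.snd R A X)
  have hE : ∀ z : E, h z.1.1 = p z.1.2 := fun z => z.2
  let j : B →ₗ[R] E := (LinearMap.inr R A X ∘ₗ i).codRestrict E (fun b => by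
    have hb : i b ∈ LinearMap.ker p := hip ▸ LinearMap.mem_range_self i b
    change h 0 = p (i b)
    rw [map_zero, LinearMap.mem_ker.1 hb])
  obtain ⟨s, hs⟩ := hAB E j (LinearMap.fst R A X ∘ₗ E.subtype)
    (fun k l hkl => hi (congrArg (fun z : E => z.1.2) hkl))
    (fun a => by
      obtain ⟨x, hx⟩ := hp (h a)
      exact ⟨⟨(a, x), hx.symm⟩, rfl⟩)
    (by
      ext z
      constructor
      · rintro ⟨b, rfl⟩
        rfl
      · intro hz
        have hz' : z.1.1 = 0 := hz
        have hzi : z.1.2 ∈ LinearMap.range i := by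
          rw [hip, LinearMap.mem_ker, ← hE z, hz', map_zero]
        obtain ⟨b, hb⟩ := hzi
        exact ⟨b, Subtype.ext (Prod.ext hz'.symm hb)⟩)
  refine ⟨LinearMap.snd R A X ∘ₗ E.subtype ∘ₗ s, ?_⟩
  ext a
  have h1 : (s a).1.1 = a := LinearMap.congr_fun hs a
  have h2 := hE (s a)
  rw [h1] at h2
  exact h2.symm

/-- Maps into `B` extend along a monomorphism whose cokernel `A` satisfies `Ext¹(A, B) = 0`. -/
theorem Ext1Vanishes.exists_extension (hAB : Ext1Vanishes R A B) {i : U →ₗ[R] X} {p : X →ₗ[R] A}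
    (hi : Function.Injective i) (hp : Function.Surjective p)
    (hip : LinearMap.range i = LinearMap.ker p) (h : U →ₗ[R] B) :
    ∃ H : X →ₗ[R] B, H ∘ₗ i = h := by
  have hpi : ∀ u, p (i u) = 0 := fun u => by
    have : i u ∈ LinearMap.ker p := hip ▸ LinearMap.mem_range_self i u
    exact this
  let K : Submodule R (B × X) := LinearMap.range (h.prod (-i))
  let j : B →ₗ[R] (B × X) ⧸ K := K.mkQ ∘ₗ LinearMap.inl R B X
  let k : X →ₗ[R] (B × X) ⧸ K := K.mkQ ∘ₗ LinearMap.inr R B X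
  have hjk : ∀ u, j (h u) = k (i u) := fun u => by
    refine (Submodule.Quotient.eq K).2 ⟨u, ?_⟩
    simp
  let q : (B × X) ⧸ K →ₗ[R] A := K.liftQ (p ∘ₗ LinearMap.snd R B X) (by
    rintro _ ⟨u, rfl⟩
    simp [hpi])
  have hqk : ∀ x, q (k x) = p x := fun x => rfl
  have hqj : ∀ b, q (j b) = 0 := fun b => map_zero p
  have hj : Function.Injective j := by
    rw [injective_iff_map_eq_zero]
    intro b hb
    obtain ⟨u, hu⟩ := (Submodule.Quotient.mk_eq_zero K).1 hb
    have h1 : h u = b := congrArg Prod.fst hu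
    have h2 : -(i u) = 0 := congrArg Prod.snd hu
    have h3 : u = 0 := hi (by rw [map_zero, ← neg_eq_zero, h2])
    rw [← h1, h3, map_zero]
  have hjq : LinearMap.range j = LinearMap.ker q := by
    apply le_antisymm
    · rintro _ ⟨b, rfl⟩
      exact hqj b
    · intro z hz
      obtain ⟨⟨b, x⟩, rfl⟩ := K.mkQ_surjective z
      have hx : x ∈ LinearMap.range i := by rw [hip]; exact hz
      obtain ⟨u, rfl⟩ := hx
      refine ⟨b + h u, ?_⟩
      have : K.mkQ (b, i u) = j b + k (i u) := by
        change _ = K.mkQ (b, 0) + K.mkQ (0, i u)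
        rw [← map_add]; simp
      rw [this, map_add, hjk]
  obtain ⟨s, hs⟩ := hAB _ j q hj (fun a => by
    obtain ⟨x, rfl⟩ := hp a
    exact ⟨k x, rfl⟩) hjq
  let r : X →ₗ[R] LinearMap.range j := (k - s ∘ₗ p).codRestrict _ (fun x => by
    rw [hjq, LinearMap.mem_ker, LinearMap.sub_apply, map_sub, hqk]
    have := LinearMap.congr_fun hs (p x)
    exact sub_eq_zero.2 this.symm)
  refine ⟨(LinearEquiv.ofInjective j hj).symm ∘ₗ r, ?_⟩
  ext u
  change (LinearEquiv.ofInjective j hj).symm (r (i u)) = h u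
  rw [LinearEquiv.symm_apply_eq]
  refine Subtype.ext ?_
  change k (i u) - s (p (i u)) = j (h u)
  rw [hpi, map_zero, sub_zero, hjk]

end Extensions

section Localization

variable {R : Type} [CommRing R] {S : Submonoid R}

theorem Localization.bijective_smul {s : R} (hs : s ∈ S) :
    Function.Bijective (fun z : Localization S => s • z) :=
  (Module.End.isUnit_iff _).1
    (IsLocalizedModule.map_units (Algebra.linearMap R (Localization S)) (⟨s, hs⟩ : S))

theorem Localization.sDivisible : SDivisible R S (Localization S) :=
  fun _ hs => (Localization.bijective_smul hs).2

theorem Localization.linearMap_eq_id {f : Localization S →ₗ[R] Localization S} (hf : f 1 = 1) :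
    f = LinearMap.id := by
  refine IsLocalizedModule.ext S (Algebra.linearMap R (Localization S))
    (IsLocalizedModule.map_units (Algebra.linearMap R (Localization S))) ?_
  ext
  simp [hf]

theorem Localization.exists_linearMap_apply_one {F : Type} [AddCommGroup F] [Module R F]
    (hF : ∀ s ∈ S, Function.Bijective (fun x : F => s • x)) (x : F) :
    ∃ f : Localization S →ₗ[R] F, f 1 = x := by
  refine ⟨IsLocalizedModule.lift S (Algebra.linearMap R (Localization S))
    (LinearMap.toSpanSingleton R F x) (fun s => (Module.End.isUnit_iff _).2 (hF s s.2)), ?_⟩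
  have := IsLocalizedModule.lift_apply S (Algebra.linearMap R (Localization S))
    (LinearMap.toSpanSingleton R F x) (fun s => (Module.End.isUnit_iff _).2 (hF s s.2)) 1
  simpa using this

variable {X Y : Type} [AddCommGroup X] [AddCommGroup Y] [Module R X] [Module R Y]

theorem Localization.exists_lift_of_smul_ker_eq_zero {p : X →ₗ[R] Y} (hp : Function.Surjective p)
    {s : R} (hs : s ∈ S) (hsp : ∀ x, p x = 0 → s • x = 0) (h : Localization S →ₗ[R] Y) :
    ∃ h' : Localization S →ₗ[R] X, p ∘ₗ h' = h := by
  obtain ⟨c, hc⟩ := LinearMap.exists_comp_eq (b := LinearMap.lsmul R X s) hp hsp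
  have hpc : ∀ y, p (c y) = s • y := fun y => by
    obtain ⟨x, rfl⟩ := hp y
    rw [show c (p x) = s • x from LinearMap.congr_fun hc x, map_smul]
  let e := LinearEquiv.ofBijective (LinearMap.lsmul R (Localization S) s)
    (Localization.bijective_smul hs)
  refine ⟨c ∘ₗ h ∘ₗ e.symm, ?_⟩
  ext z
  obtain ⟨w, rfl⟩ := e.surjective z
  simp only [LinearMap.comp_apply, LinearEquiv.coe_coe, LinearEquiv.symm_apply_apply, hpc]
  exact (map_smul h s w).symm

theorem SWeaklyCotorsion.of_smul_eq_zero {s : R} (hs : s ∈ S) (hX : ∀ x : X, s • x = 0) :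
    SWeaklyCotorsion R S X := by
  intro Z _ _ i p _ hp hip
  refine Localization.exists_lift_of_smul_ker_eq_zero hp hs (fun z hz => ?_) LinearMap.id
  obtain ⟨x, rfl⟩ : z ∈ LinearMap.range i := hip ▸ hz
  rw [← map_smul, hX, map_zero]

theorem SStronglyFlat.of_projective [Module.Projective R X] : SStronglyFlat R S X :=
  fun _ _ _ _ _ _ _ _ p _ hp _ => Module.projective_lifting_property p LinearMap.id hp

theorem SStronglyFlat.of_retract (hX : SStronglyFlat R S X) (a : Y →ₗ[R] X) (b : X →ₗ[R] Y)
    (hab : b ∘ₗ a = LinearMap.id) : SStronglyFlat R S Y := by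
  intro N _ _ hN Z _ _ i p hi hp hip
  obtain ⟨h, hh⟩ := (hX N hN).exists_lift hi hp hip b
  refine ⟨h ∘ₗ a, ?_⟩
  rw [← LinearMap.comp_assoc, hh, hab]

theorem SStronglyFlat.finsupp {ι : Type} : SStronglyFlat R S (ι →₀ Localization S) := by
  intro N _ _ hN Z _ _ i p hi hp hip
  choose h hh using fun j : ι => hN.exists_lift hi hp hip (Finsupp.lsingle j)
  refine ⟨Finsupp.lsum R h, ?_⟩
  ext j z : 2
  simpa using LinearMap.congr_fun (hh j) z

theorem SStronglyFlat.of_bijective_smul [IsSemisimpleRing (Localization S)]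
    (hX : ∀ s ∈ S, Function.Bijective (fun x : X => s • x)) : SStronglyFlat R S X := by
  have : Module.Projective (Localization S) (LocalizedModule S X) :=
    Module.projective_of_isSemisimpleRing _ _
  obtain ⟨σ, hσ⟩ := Module.projective_lifting_property
    (Finsupp.linearCombination (Localization S) (id : LocalizedModule S X → LocalizedModule S X))
    LinearMap.id (Finsupp.linearCombination_id_surjective _ _)
  have hloc : IsLocalizedModule S (LinearMap.id : X →ₗ[R] X) :=
    { map_units := fun s => (Module.End.isUnit_iff _).2 (hX s s.2)
      surj := fun x => ⟨(x, 1), by simp⟩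
      exists_of_eq := fun h => ⟨1, by simpa using h⟩ }
  let e : LocalizedModule S X ≃ₗ[R] X := IsLocalizedModule.iso S (LinearMap.id : X →ₗ[R] X)
  refine (SStronglyFlat.finsupp (ι := LocalizedModule S X)).of_retract
    (σ.restrictScalars R ∘ₗ e.symm)
    (e ∘ₗ (Finsupp.linearCombination (Localization S) id).restrictScalars R) ?_
  ext x
  have := LinearMap.congr_fun hσ (e.symm x)
  simp only [LinearMap.comp_apply, LinearMap.id_apply] at this
  simp [this]

end Localization

section Covers

variable {R : Type} [CommRing R] {S : Submonoid R}

theorem SDivisible.of_extension {D X A : Type} [AddCommGroup D] [AddCommGroup X] [AddCommGroup A]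
    [Module R D] [Module R X] [Module R A] (hD : SDivisible R S D) (hA : SDivisible R S A)
    {i : D →ₗ[R] X} {p : X →ₗ[R] A} (hp : Function.Surjective p)
    (hip : LinearMap.range i = LinearMap.ker p) : SDivisible R S X := by
  intro s hs x
  obtain ⟨a, ha⟩ := hA s hs (p x)
  obtain ⟨y, rfl⟩ := hp a
  have hxy : x - s • y ∈ LinearMap.range i := by
    rw [hip, LinearMap.mem_ker, map_sub, map_smul, ha, sub_self]
  obtain ⟨d, hd⟩ := hxy
  obtain ⟨d', rfl⟩ := hD s hs d
  refine ⟨i d' + y, ?_⟩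
  rw [smul_add, ← map_smul, hd, sub_add_cancel]

theorem SDivisible.of_surjective {D X : Type} [AddCommGroup D] [AddCommGroup X]
    [Module R D] [Module R X] (hD : SDivisible R S D) {p : D →ₗ[R] X}
    (hp : Function.Surjective p) : SDivisible R S X := by
  intro s hs x
  obtain ⟨d, rfl⟩ := hp x
  obtain ⟨d', rfl⟩ := hD s hs d
  exact ⟨p d', (map_smul p s d').symm⟩

theorem SDivisible.of_injective (hreg : S ≤ nonZeroDivisors R) {E : Type} [AddCommGroup E]
    [Module R E] (hE : Module.Injective R E) : SDivisible R S E := by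
  intro s hs x
  obtain ⟨h, hh⟩ := hE.out (LinearMap.lsmul R R s)
    (fun a b hab => (mul_cancel_left_mem_nonZeroDivisors (hreg hs)).1 hab)
    (LinearMap.toSpanSingleton R E x)
  refine ⟨h 1, ?_⟩
  have := hh 1
  rw [LinearMap.lsmul_apply, map_smul] at this
  simpa using this

/-- If every `S`-divisible module is a union of images of maps from `R_S`, then `S`-divisible
modules are `S`-weakly cotorsion. -/
theorem SDivisible.sWeaklyCotorsion
    (H : ∀ (M : Type) [AddCommGroup M] [Module R M], SDivisible R S M →
      ∀ m : M, ∃ f : Localization S →ₗ[R] M, f 1 = m)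
    {D : Type} [AddCommGroup D] [Module R D] (hD : SDivisible R S D) :
    SWeaklyCotorsion R S D := by
  intro X _ _ i p _ hp hip
  obtain ⟨x, hx⟩ := hp 1
  obtain ⟨f, hf⟩ := H X (hD.of_extension Localization.sDivisible hp hip) x
  exact ⟨f, Localization.linearMap_eq_id (by rw [LinearMap.comp_apply, hf, hx])⟩

theorem exists_linearMap_apply_one_of_cover {M F : Type} [AddCommGroup M] [Module R M]
    [AddCommGroup F] [Module R F] (hM : SDivisible R S M) {f : F →ₗ[R] M}
    (hF : SStronglyFlat R S F)
    (hpre : ∀ (G : Type) [AddCommGroup G] [Module R G], SStronglyFlat R S G →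
      ∀ g : G →ₗ[R] M, ∃ g' : G →ₗ[R] F, f ∘ₗ g' = g)
    (hcov : ∀ h : F →ₗ[R] F, f ∘ₗ h = f → Function.Bijective h) (m : M) :
    ∃ g : Localization S →ₗ[R] M, g 1 = m := by
  have hbij : ∀ s ∈ S, Function.Bijective (fun x : F => s • x) := by
    intro s hs
    obtain ⟨f₁, hf₁⟩ := (hF (LinearMap.ker (LinearMap.lsmul R M s))
      (SWeaklyCotorsion.of_smul_eq_zero hs (fun x => Subtype.ext x.2))).exists_lift
      (p := LinearMap.lsmul R M s) (Submodule.injective_subtype _) (hM s hs)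
      (Submodule.range_subtype _) f
    obtain ⟨φ, hφ⟩ := hpre F hF f₁
    have hb := hcov (s • φ) (by rw [LinearMap.comp_smul, hφ]; exact hf₁)
    constructor
    · intro x y hxy
      apply hb.1
      change s • φ x = s • φ y
      rw [← map_smul, ← map_smul]
      exact congrArg φ hxy
    · intro x
      obtain ⟨y, hy⟩ := hb.2 x
      exact ⟨φ y, hy⟩
  obtain ⟨g, hg⟩ := hpre R SStronglyFlat.of_projective (LinearMap.toSpanSingleton R M m)
  obtain ⟨k, hk⟩ := Localization.exists_linearMap_apply_one hbij (g 1)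
  refine ⟨f ∘ₗ k, ?_⟩
  have := LinearMap.congr_fun hg 1
  rw [LinearMap.comp_apply, LinearMap.toSpanSingleton_apply, one_smul] at this
  rw [LinearMap.comp_apply, hk, this]

/-- Evaluation at `1`. -/
def evalOne (S : Submonoid R) (M : Type) [AddCommGroup M] [Module R M] :
    (Localization S →ₗ[R] M) →ₗ[R] M :=
  LinearMap.applyₗ 1

/-- The action of `R_S` on homomorphisms out of `R_S`, as a map in the scalar. -/
def precompMul {M : Type} [AddCommGroup M] [Module R M] (θ : Localization S →ₗ[R] M) :
    Localization S →ₗ[R] (Localization S →ₗ[R] M) :=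
  LinearMap.llcomp R _ _ _ θ ∘ₗ LinearMap.mul R (Localization S)

theorem bijective_smul_localization_linearMap {M : Type} [AddCommGroup M] [Module R M] {s : R}
    (hs : s ∈ S) : Function.Bijective (fun φ : Localization S →ₗ[R] M => s • φ) := by
  obtain ⟨q, hq⟩ := Localization.sDivisible s hs (1 : Localization S)
  have hz : ∀ z : Localization S, s • (q * z) = z := fun z => by
    rw [← smul_mul_assoc, hq, one_mul]
  constructor
  · intro φ ψ h
    ext z
    rw [← hz z, map_smul, map_smul]
    exact LinearMap.congr_fun h (q * z)
  · intro φ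
    refine ⟨precompMul φ q, ?_⟩
    ext z
    change s • φ (q * z) = φ z
    rw [← map_smul, hz]

theorem sWeaklyCotorsion_ker_evalOne
    (H : ∀ (M : Type) [AddCommGroup M] [Module R M], SDivisible R S M →
      ∀ m : M, ∃ f : Localization S →ₗ[R] M, f 1 = m)
    (M : Type) [AddCommGroup M] [Module R M] :
    SWeaklyCotorsion R S (LinearMap.ker (evalOne S M)) := by
  intro X _ _ i p hi hp hip
  have hdiv : SDivisible R S (Localization S →ₗ[R] M) :=
    fun s hs => (bijective_smul_localization_linearMap hs).2
  obtain ⟨r, hr⟩ := (hdiv.sWeaklyCotorsion H).exists_extension hi hp hip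
    (LinearMap.ker (evalOne S M)).subtype
  have hpi : ∀ u, p (i u) = 0 := fun u => by
    have : i u ∈ LinearMap.ker p := hip ▸ LinearMap.mem_range_self i u
    exact this
  obtain ⟨θ, hθ⟩ := LinearMap.exists_comp_eq (b := evalOne S M ∘ₗ r) hp (by
    intro x hx
    obtain ⟨k, rfl⟩ : x ∈ LinearMap.range i := hip ▸ hx
    rw [LinearMap.comp_apply, show r (i k) = k from LinearMap.congr_fun hr k]
    exact k.2)
  let r' : X →ₗ[R] LinearMap.ker (evalOne S M) :=
    (r - precompMul θ ∘ₗ p).codRestrict _ (fun x => by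
      rw [LinearMap.mem_ker, LinearMap.sub_apply, map_sub, sub_eq_zero]
      have := LinearMap.congr_fun hθ x
      rw [LinearMap.comp_apply, LinearMap.comp_apply] at this
      rw [← this]
      change θ (p x) = θ (p x * 1)
      rw [mul_one])
  have hr' : ∀ k, r' (i k) = k := fun k => Subtype.ext (by
    change r (i k) - precompMul θ (p (i k)) = k
    rw [hpi, map_zero, sub_zero]
    exact LinearMap.congr_fun hr k)
  obtain ⟨σ, hσ⟩ := LinearMap.exists_comp_eq (b := LinearMap.id - i ∘ₗ r') hp (by
    intro x hx
    obtain ⟨k, rfl⟩ : x ∈ LinearMap.range i := hip ▸ hx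
    rw [LinearMap.sub_apply, LinearMap.comp_apply, hr', LinearMap.id_apply,
      sub_self])
  refine ⟨σ, ?_⟩
  ext a
  obtain ⟨x, rfl⟩ := hp a
  have := LinearMap.congr_fun hσ x
  rw [LinearMap.comp_apply] at this
  rw [LinearMap.comp_apply, this, LinearMap.sub_apply, map_sub, LinearMap.comp_apply, hpi,
    sub_zero]
  rfl

theorem eq_id_of_evalOne_comp_eq {M : Type} [AddCommGroup M] [Module R M]
    {h : (Localization S →ₗ[R] M) →ₗ[R] (Localization S →ₗ[R] M)}
    (hh : evalOne S M ∘ₗ h = evalOne S M) : h = LinearMap.id := by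
  have h1 : ∀ φ, h φ 1 = φ 1 := LinearMap.congr_fun hh
  ext φ : 1
  refine LinearMap.ext fun z => ?_
  obtain ⟨⟨r, s⟩, hrs⟩ := IsLocalization.surj S z
  have hz : (s : R) • z = r • (1 : Localization S) := by
    rw [Algebra.smul_def, Algebra.smul_def, mul_one, mul_comm]; exact hrs
  obtain ⟨ψ, rfl⟩ := (bijective_smul_localization_linearMap (M := M) s.2).2 φ
  change h ((s : R) • ψ) z = (s : R) • ψ z
  rw [map_smul, LinearMap.smul_apply, ← map_smul, ← map_smul, hz, map_smul, map_smul, h1]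

theorem exists_cover_of_exists_linearMap_apply_one [IsSemisimpleRing (Localization S)]
    (H : ∀ (M : Type) [AddCommGroup M] [Module R M], SDivisible R S M →
      ∀ m : M, ∃ f : Localization S →ₗ[R] M, f 1 = m)
    (M : Type) [AddCommGroup M] [Module R M] (hM : SDivisible R S M) :
    ∃ (F : Type) (_ : AddCommGroup F) (_ : Module R F) (f : F →ₗ[R] M),
      SStronglyFlat R S F ∧
      (∀ (G : Type) [AddCommGroup G] [Module R G], SStronglyFlat R S G →
        ∀ g : G →ₗ[R] M, ∃ g' : G →ₗ[R] F, f ∘ₗ g' = g) ∧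
      (∀ h : F →ₗ[R] F, f ∘ₗ h = f → Function.Bijective h) := by
  refine ⟨Localization S →ₗ[R] M, inferInstance, inferInstance, evalOne S M,
    SStronglyFlat.of_bijective_smul fun s hs => bijective_smul_localization_linearMap hs, ?_, ?_⟩
  · intro G _ _ hG g
    exact (hG _ (sWeaklyCotorsion_ker_evalOne H M)).exists_lift (p := evalOne S M)
      (Submodule.injective_subtype _) (H M hM) (Submodule.range_subtype _) g
  · intro h hh
    rw [eq_id_of_evalOne_comp_eq hh]
    exact Function.bijective_id

end Covers

section ProjectiveDimension

variable {R : Type} [CommRing R] {S : Submonoid R}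

theorem exists_injective_embedding (X : Type) [AddCommGroup X] [Module R X] :
    ∃ (E : Type) (_ : AddCommGroup E) (_ : Module R E) (j : X →ₗ[R] E),
      Module.Injective R E ∧ Function.Injective j := by
  let E := CategoryTheory.Injective.under (ModuleCat.of R X)
  refine ⟨E, inferInstance, inferInstance, (CategoryTheory.Injective.ι (ModuleCat.of R X)).hom,
    ?_, ?_⟩
  · have : CategoryTheory.Injective (ModuleCat.of R E) :=
      inferInstanceAs (CategoryTheory.Injective E)
    exact Module.injective_module_of_injective_object R E
  · exact (ModuleCat.mono_iff_injective _).1 inferInstance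

theorem sMatlis_of_exists_linearMap_apply_one (hreg : S ≤ nonZeroDivisors R)
    (H : ∀ (M : Type) [AddCommGroup M] [Module R M], SDivisible R S M →
      ∀ m : M, ∃ f : Localization S →ₗ[R] M, f 1 = m) : SMatlis R S := by
  let π : (Localization S →₀ R) →ₗ[R] Localization S := Finsupp.linearCombination R id
  have hπ : Function.Surjective π := Finsupp.linearCombination_id_surjective _ _
  refine ⟨_, inferInstance, inferInstance, π, inferInstance, hπ, ?_⟩
  refine Module.Projective.of_lifting_property'' fun f hf => ?_
  obtain ⟨E, _, _, j, hE, hj⟩ := exists_injective_embedding (R := R)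
    (LinearMap.ker π →₀ R)
  let K := (LinearMap.ker f).map j
  have hD : SDivisible R S (E ⧸ K) :=
    (SDivisible.of_injective hreg hE).of_surjective K.mkQ_surjective
  obtain ⟨b, hb⟩ := LinearMap.exists_comp_eq (b := K.mkQ ∘ₗ j) hf (fun x hx => by
    rw [LinearMap.comp_apply, Submodule.mkQ_apply, Submodule.Quotient.mk_eq_zero]
    exact Submodule.mem_map_of_mem hx)
  obtain ⟨G, hG⟩ := (hD.sWeaklyCotorsion H).exists_extension (Submodule.injective_subtype _) hπ
    (Submodule.range_subtype _) b
  obtain ⟨G', hG'⟩ := Module.projective_lifting_property K.mkQ G K.mkQ_surjective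
  have hmem : ∀ y : LinearMap.ker π, ∃ x, f x = y ∧ j x = G' y := by
    intro y
    obtain ⟨x, rfl⟩ := hf y
    have h1 : K.mkQ (G' (f x)) = K.mkQ (j x) := by
      have e1 := LinearMap.congr_fun hG' (f x : Localization S →₀ R)
      have e2 := LinearMap.congr_fun hG (f x)
      have e3 := LinearMap.congr_fun hb x
      exact e1.trans (e2.trans e3)
    obtain ⟨n, hn, hn'⟩ := (Submodule.Quotient.eq K).1 h1
    refine ⟨n + x, ?_, ?_⟩
    · rw [map_add, show f n = 0 from hn, zero_add]
    · rw [map_add, hn', sub_add_cancel]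
  let L : LinearMap.ker π →ₗ[R] LinearMap.range j :=
    (G' ∘ₗ (LinearMap.ker π).subtype).codRestrict _ (fun y => by
      obtain ⟨x, -, hx⟩ := hmem y
      exact ⟨x, hx⟩)
  refine ⟨(LinearEquiv.ofInjective j hj).symm ∘ₗ L, ?_⟩
  ext1 y
  obtain ⟨x, hx, hx'⟩ := hmem y
  have : (LinearEquiv.ofInjective j hj).symm (L y) = x := by
    rw [LinearEquiv.symm_apply_eq]
    exact Subtype.ext hx'.symm
  rw [LinearMap.comp_apply, LinearMap.comp_apply, LinearEquiv.coe_coe, this, hx,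
    LinearMap.id_apply]

end ProjectiveDimension

section Relations

variable (R : Type) [CommRing R]

/-- The canonical free presentation of `M`, with one generator for each element. -/
noncomputable abbrev freePresentation (M : Type) [AddCommGroup M] [Module R M] :
    (M →₀ R) →ₗ[R] M :=
  Finsupp.linearCombination R id

variable {R}

theorem projective_ker_freePresentation {M P : Type} [AddCommGroup M] [Module R M]
    [AddCommGroup P] [Module R P] [Module.Projective R P] {f : P →ₗ[R] M}
    (hf : Function.Surjective f) [Module.Projective R (LinearMap.ker f)] :
    Module.Projective R (LinearMap.ker (freePresentation R M)) := by
  have hπ : Function.Surjective (freePresentation R M) :=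
    Finsupp.linearCombination_id_surjective _ _
  obtain ⟨a, ha⟩ := Module.projective_lifting_property (freePresentation R M) f hπ
  obtain ⟨b, hb⟩ := Module.projective_lifting_property f (freePresentation R M) hf
  have ha' : ∀ x, freePresentation R M (a x) = f x := LinearMap.congr_fun ha
  have hb' : ∀ x, f (b x) = freePresentation R M x := LinearMap.congr_fun hb
  let i : LinearMap.ker (freePresentation R M) →ₗ[R] (M →₀ R) × LinearMap.ker f :=
    (LinearMap.ker (freePresentation R M)).subtype.prod
      ((b ∘ₗ (LinearMap.ker (freePresentation R M)).subtype).codRestrict _ (fun k => by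
        change f (b k) = 0
        rw [hb', LinearMap.mem_ker.1 k.2]))
  let s : (M →₀ R) × LinearMap.ker f →ₗ[R] LinearMap.ker (freePresentation R M) :=
    LinearMap.coprod
      ((LinearMap.id - a ∘ₗ b).codRestrict _ (fun x => by
        rw [LinearMap.mem_ker, LinearMap.sub_apply, map_sub, LinearMap.comp_apply, ha', hb',
          LinearMap.id_apply, sub_self]))
      ((a ∘ₗ (LinearMap.ker f).subtype).codRestrict _ (fun x => by
        change freePresentation R M (a x) = 0
        rw [ha', LinearMap.mem_ker.1 x.2]))
  refine Module.Projective.of_split i s ?_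
  ext1 k
  refine Subtype.ext ?_
  change ((k : M →₀ R) - a (b k)) + a (b k) = k
  rw [sub_add_cancel]

variable {Q : Type} [CommRing Q] [Algebra R Q] {S : Submonoid R}

theorem bijective_smul_of_isLocalization (S : Submonoid R) [IsLocalization S Q] {s : R}
    (hs : s ∈ S) :
    Function.Bijective (fun z : Q => s • z) :=
  (Module.End.isUnit_iff _).1
    (IsLocalizedModule.map_units (Algebra.linearMap R Q) (⟨s, hs⟩ : S))

/-- The set `X` is closed under the relations occurring in the coordinates, along the section `i`,
of the relations supported on `X`. -/
def RelClosed
    (i : LinearMap.ker (freePresentation R Q) →ₗ[R] (LinearMap.ker (freePresentation R Q) →₀ R))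
    (X : Set Q) : Prop :=
  ∀ p : LinearMap.ker (freePresentation R Q), p.1 ∈ Finsupp.supported R R X →
    ∀ y ∈ (i p).support, y.1 ∈ Finsupp.supported R R X

/-- `Hom(B, -)` preserves surjections whose kernel is killed by an element of `S`. -/
def LiftsModulo (S : Submonoid R) (B : Type) [AddCommGroup B] [Module R B] : Prop :=
  ∀ (X Y : Type) [AddCommGroup X] [AddCommGroup Y] [Module R X] [Module R Y] (p : X →ₗ[R] Y),
    Function.Surjective p → ∀ s ∈ S, (∀ x, p x = 0 → s • x = 0) → ∀ h : B →ₗ[R] Y,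
      ∃ h' : B →ₗ[R] X, p ∘ₗ h' = h

/-- The map onto the span of `X` from the free module on `X`. -/
noncomputable def spanProj (X : Set Q) :
    Finsupp.supported R R X →ₗ[R] Submodule.span R X :=
  (freePresentation R Q ∘ₗ (Finsupp.supported R R X).subtype).codRestrict _ (fun x => by
    have := (Finsupp.mem_span_image_iff_linearCombination R (v := (id : Q → _))
      (s := X) (x := freePresentation R Q x.1)).2 ⟨x.1, x.2, rfl⟩
    rwa [Set.image_id] at this)

theorem spanProj_apply (X : Set Q) (x : Finsupp.supported R R X) :
    (spanProj X x : Q) = freePresentation R Q x.1 :=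
  rfl

theorem mem_ker_freePresentation_of_spanProj_eq_zero {X : Set Q}
    {x : Finsupp.supported R R X} (hx : spanProj X x = 0) :
    x.1 ∈ LinearMap.ker (freePresentation R Q) :=
  congrArg Subtype.val hx

theorem spanProj_surjective (X : Set Q) :
    Function.Surjective (spanProj (R := R) X) := by
  intro z
  obtain ⟨l, hl, h⟩ := (Finsupp.mem_span_image_iff_linearCombination R
    (v := (id : Q → _)) (s := X)).1 (by rw [Set.image_id]; exact z.2)
  exact ⟨⟨l, hl⟩, Subtype.ext h⟩

theorem exists_linearMap_span {X : Set Q} {D : Type} [AddCommGroup D] [Module R D]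
    {g : Q → D}
    (hg : ∀ p ∈ LinearMap.ker (freePresentation R Q), p ∈ Finsupp.supported R R X →
      Finsupp.linearCombination R g p = 0) :
    ∃ f : Submodule.span R X →ₗ[R] D, ∀ x (hx : x ∈ Submodule.span R X), x ∈ X →
      f ⟨x, hx⟩ = g x := by
  have hle : ∀ p, spanProj X p = 0 →
      (Finsupp.linearCombination R g ∘ₗ (Finsupp.supported R R X).subtype) p = 0 :=
    fun p hp => hg p.1 (mem_ker_freePresentation_of_spanProj_eq_zero hp) p.2
  obtain ⟨f, hf⟩ := LinearMap.exists_comp_eq (U := Finsupp.supported R R X)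
    (spanProj_surjective X) hle
  refine ⟨f, fun x hx hxX => ?_⟩
  have h := LinearMap.congr_fun hf ⟨Finsupp.single x 1, Finsupp.single_mem_supported R 1 hxX⟩
  have hx' : spanProj X ⟨Finsupp.single x 1, Finsupp.single_mem_supported R 1 hxX⟩ = ⟨x, hx⟩ := by
    refine Subtype.ext ?_
    simp [spanProj_apply]
  rw [LinearMap.comp_apply, hx'] at h
  simpa using h

theorem RelClosed.exists_retraction
    {i : LinearMap.ker (freePresentation R Q) →ₗ[R] (LinearMap.ker (freePresentation R Q) →₀ R)}
    (hi : Finsupp.linearCombination R id ∘ₗ i = LinearMap.id)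
    {X : Set Q} (hX : RelClosed i X) :
    ∃ e : LinearMap.ker (freePresentation R Q) →ₗ[R] LinearMap.ker (freePresentation R Q),
      (∀ k, (e k).1 ∈ Finsupp.supported R R X) ∧
      ∀ k, k.1 ∈ Finsupp.supported R R X → e k = k := by
  classical
  let T : Set (LinearMap.ker (freePresentation R Q)) := {y | y.1 ∈ Finsupp.supported R R X}
  refine ⟨Finsupp.linearCombination R id ∘ₗ (Finsupp.supported R R T).subtype ∘ₗ
    Finsupp.restrictDom R R T ∘ₗ i, fun k => ?_, fun k hk => ?_⟩
  · have : Finsupp.linearCombination R id (Finsupp.restrictDom R R T (i k)).1 ∈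
        (Finsupp.supported R R X).comap (LinearMap.ker (freePresentation R Q)).subtype :=
      Submodule.sum_mem _ fun y hy =>
        Submodule.smul_mem _ _ ((Finsupp.restrictDom R R T (i k)).2 hy)
    exact this
  · have h : (Finsupp.restrictDom R R T (i k)).1 = i k := by
      rw [Finsupp.restrictDom_apply, Finsupp.filter_eq_self_iff]
      exact fun y hy => hX k hk y (Finsupp.mem_support_iff.2 hy)
    simp only [LinearMap.comp_apply, Submodule.subtype_apply, h]
    exact LinearMap.congr_fun hi k

theorem exists_extension_of_smul_eq_zero [IsLocalization S Q] {N : Type} [AddCommGroup N]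
    [Module R N] {s : R}
    (hs : s ∈ S) (hN : ∀ x : N, s • x = 0) (w : LinearMap.ker (freePresentation R Q) →ₗ[R] N) :
    ∃ W : (Q →₀ R) →ₗ[R] N, ∀ k : LinearMap.ker (freePresentation R Q),
      W k.1 = w k := by
  let I := LinearMap.range (LinearMap.lsmul R (Q →₀ R) s)
  have ha : Function.Surjective (I.mkQ ∘ₗ (LinearMap.ker (freePresentation R Q)).subtype) := by
    intro y
    obtain ⟨x, rfl⟩ := Submodule.mkQ_surjective _ y
    obtain ⟨z, hz⟩ := (bijective_smul_of_isLocalization S hs).2 (freePresentation R Q x)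
    obtain ⟨x', hx'⟩ := Finsupp.linearCombination_id_surjective R Q z
    refine ⟨⟨x - s • x', ?_⟩, ?_⟩
    · rw [LinearMap.mem_ker, map_sub, map_smul, hx']
      exact sub_eq_zero.2 hz.symm
    · change Submodule.Quotient.mk (x - s • x') = Submodule.Quotient.mk x
      rw [Submodule.Quotient.eq]
      exact ⟨-x', by simp⟩
  have hle : ∀ k, (I.mkQ ∘ₗ (LinearMap.ker (freePresentation R Q)).subtype) k = 0 →
      w k = 0 := by
    intro k hk
    rw [LinearMap.comp_apply, Submodule.mkQ_apply,
      Submodule.Quotient.mk_eq_zero] at hk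
    obtain ⟨x, hx⟩ := hk
    have hx' : s • x = k.1 := hx
    have hxK : x ∈ LinearMap.ker (freePresentation R Q) := by
      have h1 : freePresentation R Q (s • x) = 0 := by rw [hx']; exact k.2
      rw [map_smul] at h1
      exact (bijective_smul_of_isLocalization S hs).1 (h1.trans (smul_zero s).symm)
    have hk' : k = s • (⟨x, hxK⟩ : LinearMap.ker (freePresentation R Q)) := Subtype.ext hx'.symm
    rw [hk', map_smul, hN]
  obtain ⟨c, hc⟩ := LinearMap.exists_comp_eq (U := LinearMap.ker (freePresentation R Q)) ha hle
  exact ⟨c ∘ₗ I.mkQ, LinearMap.congr_fun hc⟩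

theorem RelClosed.liftsModulo_span [IsLocalization S Q]
    {i : LinearMap.ker (freePresentation R Q) →ₗ[R] (LinearMap.ker (freePresentation R Q) →₀ R)}
    (hi : Finsupp.linearCombination R id ∘ₗ i = LinearMap.id)
    {X : Set Q} (hX : RelClosed i X) : LiftsModulo S (Submodule.span R X) := by
  classical
  intro M N _ _ _ _ p hp s hs hsp h
  obtain ⟨e, he, he'⟩ := hX.exists_retraction hi
  obtain ⟨g, hg⟩ := Module.projective_lifting_property p
    (h ∘ₗ spanProj X ∘ₗ Finsupp.restrictDom R R X) hp
  have hgA : ∀ x : Finsupp.supported R R X, p (g x.1) = h (spanProj X x) := by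
    intro x
    have h1 : Finsupp.restrictDom R R X x.1 = x := by
      refine Subtype.ext ?_
      rw [Finsupp.restrictDom_apply, Finsupp.filter_eq_self_iff]
      exact fun y hy => x.2 (Finsupp.mem_support_iff.2 hy)
    have := LinearMap.congr_fun hg x.1
    rwa [LinearMap.comp_apply, LinearMap.comp_apply, LinearMap.comp_apply, h1] at this
  obtain ⟨W, hW⟩ := exists_extension_of_smul_eq_zero hs
    (fun x : LinearMap.ker p => Subtype.ext (hsp x.1 x.2))
    ((g ∘ₗ (LinearMap.ker (freePresentation R Q)).subtype ∘ₗ e).codRestrict (LinearMap.ker p)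
      (fun k => by
        have h1 : spanProj X ⟨(e k).1, he k⟩ = 0 := Subtype.ext (LinearMap.mem_ker.1 (e k).2)
        exact (hgA ⟨(e k).1, he k⟩).trans (by rw [h1, map_zero])))
  have hle : ∀ x, spanProj X x = 0 →
      ((g - (LinearMap.ker p).subtype ∘ₗ W) ∘ₗ (Finsupp.supported R R X).subtype) x = 0 := by
    intro x hx
    have hxK := mem_ker_freePresentation_of_spanProj_eq_zero hx
    have h1 : (W x.1).1 = g (e ⟨x.1, hxK⟩).1 := congrArg Subtype.val (hW ⟨x.1, hxK⟩)
    rw [he' _ x.2] at h1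
    exact sub_eq_zero.2 h1.symm
  obtain ⟨h', hh'⟩ := LinearMap.exists_comp_eq (U := Finsupp.supported R R X)
    (spanProj_surjective X) hle
  refine ⟨h', ?_⟩
  ext1 z
  obtain ⟨x, rfl⟩ := spanProj_surjective X z
  have h1 : h' (spanProj X x) = g x.1 - (W x.1).1 := LinearMap.congr_fun hh' x
  rw [LinearMap.comp_apply, h1, map_sub, hgA, LinearMap.mem_ker.1 (W x.1).2, sub_zero]

end Relations

section PartialLocalization

variable {R Q : Type} [CommRing R] [CommRing Q] [Algebra R Q] {S : Submonoid R}

/-- The submodule `B` of `Q` is a subring generated by fractions whose denominators are already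
inverted in `B`. -/
structure IsPartialLocalization (S : Submonoid R) (B : Submodule R Q) : Prop where
  one_mem : 1 ∈ B
  mul_mem : ∀ z ∈ B, ∀ w ∈ B, z * w ∈ B
  exists_den : ∀ z ∈ B, ∃ u ∈ S, ∃ r : R, ∃ v ∈ B, u • z = algebraMap R Q r ∧ u • v = 1

theorem IsPartialLocalization.exists_common_den {B : Submodule R Q}
    (hB : IsPartialLocalization S B) (F : Finset B) :
    ∃ u ∈ S, ∃ v ∈ B, u • v = 1 ∧ ∀ z ∈ F, ∃ r : R, u • (z : Q) = algebraMap R Q r := by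
  classical
  induction F using Finset.induction_on with
  | empty => exact ⟨1, S.one_mem, 1, hB.one_mem, one_smul R 1, by simp⟩
  | insert z F _ ih =>
    obtain ⟨u, hu, v, hv, huv, h⟩ := ih
    obtain ⟨u', hu', r', v', hv', hz, huv'⟩ := hB.exists_den z z.2
    refine ⟨u * u', S.mul_mem hu hu', v * v', hB.mul_mem v hv v' hv', ?_, fun w hw => ?_⟩
    · rw [mul_smul, ← mul_smul_comm, huv', mul_one, huv]
    · rcases Finset.mem_insert.1 hw with rfl | hw
      · exact ⟨u * r', by rw [mul_smul, hz, map_mul, Algebra.smul_def]⟩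
      · obtain ⟨r, hr⟩ := h w hw
        exact ⟨u' * r, by rw [mul_comm, mul_smul, hr, map_mul, Algebra.smul_def]⟩

theorem IsPartialLocalization.exists_finset_le {B : Submodule R Q}
    (hB : IsPartialLocalization S B) (hL : LiftsModulo S B) {s : R} (hs : s ∈ S) :
    ∃ F : Finset B, B ≤ Submodule.span R ((↑) '' (F : Set B)) ⊔ B.map (LinearMap.lsmul R Q s) := by
  classical
  let I := LinearMap.range (LinearMap.lsmul R B s)
  let J := LinearMap.range (LinearMap.lsmul R (B →₀ R) s)
  have hJ : J ≤ LinearMap.ker (I.mkQ ∘ₗ Finsupp.linearCombination R (id : B → B)) := by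
    rintro _ ⟨x, rfl⟩
    rw [LinearMap.mem_ker, LinearMap.comp_apply, Submodule.mkQ_apply,
      Submodule.Quotient.mk_eq_zero, LinearMap.lsmul_apply, map_smul]
    exact ⟨_, rfl⟩
  obtain ⟨σ, hσ⟩ := hL _ _ (J.liftQ _ hJ) (by
    intro y
    obtain ⟨b, rfl⟩ := Submodule.mkQ_surjective _ y
    exact ⟨J.mkQ (Finsupp.single b 1), by simp⟩) s hs (by
    intro x _
    obtain ⟨x, rfl⟩ := Submodule.mkQ_surjective _ x
    rw [← map_smul, Submodule.mkQ_apply, Submodule.Quotient.mk_eq_zero]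
    exact ⟨x, rfl⟩) I.mkQ
  obtain ⟨f₁, hf₁⟩ := Submodule.mkQ_surjective _ (σ ⟨1, hB.one_mem⟩)
  refine ⟨f₁.support, fun z hz => ?_⟩
  obtain ⟨f, hf⟩ := Submodule.mkQ_surjective _ (σ ⟨z, hz⟩)
  obtain ⟨u, hu, r, v, hv, huz, huv⟩ := hB.exists_den z hz
  obtain ⟨g, hg⟩ : u • f - r • f₁ ∈ J := by
    rw [← Submodule.Quotient.mk_eq_zero, ← Submodule.mkQ_apply, map_sub, map_smul, map_smul, hf,
      hf₁, ← map_smul, ← map_smul, ← map_sub]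
    convert map_zero σ
    refine Subtype.ext ?_
    change u • z - r • (1 : Q) = 0
    rw [huz, Algebra.algebraMap_eq_smul_one, sub_self]
  obtain ⟨b, hb⟩ : (⟨z, hz⟩ : B) - Finsupp.linearCombination R id f ∈ I := by
    rw [← Submodule.Quotient.mk_eq_zero, ← Submodule.mkQ_apply, map_sub, sub_eq_zero]
    have := LinearMap.congr_fun hσ ⟨z, hz⟩
    rw [LinearMap.comp_apply, ← hf] at this
    exact this.symm
  have hz' : z = s • (b : Q) + B.subtype (Finsupp.linearCombination R id f) := by
    have := congrArg Subtype.val hb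
    exact eq_add_of_sub_eq this.symm
  rw [hz']
  refine add_mem (Submodule.mem_sup_right ⟨b, b.2, rfl⟩) ?_
  rw [Finsupp.linearCombination_apply, Finsupp.sum, map_sum]
  refine Submodule.sum_mem _ fun w _ => ?_
  by_cases hw : w ∈ f₁.support
  · exact Submodule.mem_sup_left (Submodule.smul_mem _ _ (Submodule.subset_span ⟨w, hw, rfl⟩))
  · refine Submodule.mem_sup_right ⟨v * (g w • (w : Q)),
      hB.mul_mem v hv _ (B.smul_mem _ w.2), ?_⟩
    have h1 : s * g w = u * f w := by
      have := DFunLike.congr_fun hg w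
      rw [Finsupp.notMem_support_iff] at hw
      simpa [hw] using this
    change s • (v * (g w • (w : Q))) = f w • (w : Q)
    rw [← mul_smul_comm, ← mul_smul, h1, mul_smul, mul_smul_comm, ← smul_mul_assoc, huv, one_mul]

theorem IsPartialLocalization.exists_eq_algebraMap_add_smul {B : Submodule R Q}
    (hB : IsPartialLocalization S B) (hL : LiftsModulo S B) {s : R} (hs : s ∈ S) {z : Q}
    (hz : z ∈ B) : ∃ r : R, ∃ b ∈ B, z = algebraMap R Q r + s • b := by
  obtain ⟨F, hF⟩ := hB.exists_finset_le hL hs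
  obtain ⟨u, _, v, hv, huv, hu⟩ := hB.exists_common_den F
  have hle : Submodule.span R ((↑) '' (F : Set B)) ⊔ B.map (LinearMap.lsmul R Q s) ≤
      (LinearMap.range (Algebra.linearMap R Q) ⊔ B.map (LinearMap.lsmul R Q s)).comap
        (LinearMap.lsmul R Q u) := by
    refine sup_le (Submodule.span_le.2 ?_) ?_
    · rintro _ ⟨w, hw, rfl⟩
      obtain ⟨r, hr⟩ := hu w hw
      exact Submodule.mem_sup_left ⟨r, hr.symm⟩
    · rintro _ ⟨b, hb, rfl⟩
      exact Submodule.mem_sup_right (Submodule.smul_mem _ _ ⟨b, hb, rfl⟩)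
  have h := hle (hF (hB.mul_mem v hv z hz))
  rw [Submodule.mem_comap, LinearMap.lsmul_apply, ← smul_mul_assoc, huv, one_mul,
    Submodule.mem_sup] at h
  obtain ⟨_, ⟨r, rfl⟩, _, ⟨b, hb, rfl⟩, h⟩ := h
  exact ⟨r, b, hb, h.symm⟩

theorem RelClosed.exists_finset_supported [IsLocalization S Q] [IsNoetherianRing Q]
    (hreg : S ≤ nonZeroDivisors R)
    {i : LinearMap.ker (freePresentation R Q) →ₗ[R] (LinearMap.ker (freePresentation R Q) →₀ R)}
    {X : Set Q} (hX : RelClosed i X) (Y : Finset Q) :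
    ∃ Y' : Finset Q, ∀ p : LinearMap.ker (freePresentation R Q),
      p.1 ∈ Finsupp.supported R R (X ∪ Y) →
        ∀ y ∈ (i p).support, y.1 ∈ Finsupp.supported R R (X ∪ Y') := by
  classical
  have hinj : Function.Injective (algebraMap R Q) := IsLocalization.injective Q hreg
  let j : LinearMap.ker (freePresentation R Q) →ₗ[R] (Y → Q) :=
    LinearMap.pi fun y => Algebra.linearMap R Q ∘ₗ Finsupp.lapply y.1 ∘ₗ
      (LinearMap.ker (freePresentation R Q)).subtype
  let N : Submodule R (LinearMap.ker (freePresentation R Q)) :=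
    (Finsupp.supported R R (X ∪ Y)).comap (LinearMap.ker (freePresentation R Q)).subtype
  obtain ⟨_, hZN, hZ⟩ := (Submodule.fg_span_iff_fg_span_finset_subset _).1
    (IsNoetherian.noetherian (Submodule.span Q (j '' (N : Set _))))
  obtain ⟨Z, hZ_sub, rfl⟩ := Finset.subset_set_image_iff.1 hZN
  let Y' := Z.biUnion fun z => (i z).support.biUnion fun y => y.1.support
  let U : Set (LinearMap.ker (freePresentation R Q)) :=
    {y | y.1 ∈ Finsupp.supported R R (X ∪ Y')}
  refine ⟨Y', fun p hp => ?_⟩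
  have hpZ : j p ∈ Submodule.span Q (j '' (Z : Set _)) := by
    rw [← Finset.coe_image, ← hZ]
    exact Submodule.subset_span ⟨p, hp, rfl⟩
  obtain ⟨⟨t, htS⟩, ht⟩ := multiple_mem_span_of_mem_localization_span S Q _ _ hpZ
  rw [← Submodule.map_span] at ht
  change t • j p ∈ _ at ht
  obtain ⟨z, hz, hzp⟩ := ht
  have hzN : z ∈ N := Submodule.span_le.2 hZ_sub hz
  obtain ⟨k, hkz⟩ : ∃ k : LinearMap.ker (freePresentation R Q), k + z = t • p :=
    ⟨⟨t • p.1 - z.1, sub_mem (Submodule.smul_mem _ t p.2) z.2⟩, Subtype.ext (sub_add_cancel _ _)⟩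
  have hk : k.1 ∈ Finsupp.supported R R X := by
    have hkN : k.1 ∈ Finsupp.supported R R (X ∪ Y) := by
      have h1 : k.1 = t • p.1 - z.1 := eq_sub_of_add_eq (congrArg Subtype.val hkz)
      rw [h1]
      exact sub_mem (Submodule.smul_mem _ t hp) hzN
    intro y hy
    refine (hkN hy).resolve_right fun hyY => ?_
    have h1 : j k = 0 := by
      have h2 := congrArg j hkz
      rw [map_add, hzp, map_smul] at h2
      exact add_eq_right.1 h2
    have h2 : algebraMap R Q (k.1 y) = 0 := congrFun h1 ⟨y, hyY⟩
    exact Finsupp.mem_support_iff.1 hy (hinj (h2.trans (map_zero _).symm))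
  have hkU : i k ∈ Finsupp.supported R R U := fun y hy =>
    Finsupp.supported_mono Set.subset_union_left (hX _ hk y hy)
  have hzU : i z ∈ Finsupp.supported R R U := by
    refine (Submodule.span_le (p := (Finsupp.supported R R U).comap i)).2 (fun z hz y hy => ?_) hz
    intro x hx
    exact Or.inr (Finset.mem_coe.2 (Finset.mem_biUnion.2
      ⟨z, hz, Finset.mem_biUnion.2 ⟨y, hy, hx⟩⟩))
  intro y hy
  have htU : i (t • p) ∈ Finsupp.supported R R U := by
    rw [← hkz, map_add]
    exact add_mem hkU hzU
  refine htU (Finset.mem_coe.2 (Finsupp.mem_support_iff.2 fun h => ?_))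
  rw [map_smul, Finsupp.smul_apply, smul_eq_mul] at h
  exact Finsupp.mem_support_iff.1 hy ((mul_left_mem_nonZeroDivisors_eq_zero_iff (hreg htS)).1 h)

end PartialLocalization

section Extension

variable {R Q : Type} [CommRing R] [CommRing Q] [Algebra R Q] {S : Submonoid R}

theorem RelClosed.exists_tower [IsLocalization S Q] [IsNoetherianRing Q]
    (hreg : S ≤ nonZeroDivisors R)
    {i : LinearMap.ker (freePresentation R Q) →ₗ[R] (LinearMap.ker (freePresentation R Q) →₀ R)}
    {X : Set Q} (hX : RelClosed i X) {t : R} (ht : t ∈ S) :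
    ∃ (Y : ℕ → Finset Q) (q c : ℕ → R), q 0 = 1 ∧ (∀ n, q n ∈ S) ∧ (∀ n, c n ∈ S) ∧
      (∀ n, q (n + 1) = c n * q n) ∧ (∀ n, t * q n ∣ c n) ∧
      (∀ n, ∃ y ∈ Y (n + 1), q n • y = 1) ∧ (∀ n, Y n ⊆ Y (n + 1)) ∧
      (∀ n, ∀ p : LinearMap.ker (freePresentation R Q), p.1 ∈ Finsupp.supported R R (X ∪ Y n) →
        ∀ y ∈ (i p).support, y.1 ∈ Finsupp.supported R R (X ∪ Y (n + 1))) ∧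
      (∀ n, ∀ y ∈ Y n, ∃ r : R, q n • y = algebraMap R Q r) := by
  classical
  let A := {a : Finset Q × R // a.2 ∈ S ∧ ∀ y ∈ a.1, ∃ r : R, a.2 • y = algebraMap R Q r}
  have step : ∀ a : A, ∃ (a' : A) (c : R), c ∈ S ∧ a'.1.2 = c * a.1.2 ∧ t * a.1.2 ∣ c ∧
      (∃ y ∈ a'.1.1, a.1.2 • y = 1) ∧ a.1.1 ⊆ a'.1.1 ∧
      ∀ p : LinearMap.ker (freePresentation R Q), p.1 ∈ Finsupp.supported R R (X ∪ a.1.1) →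
        ∀ y ∈ (i p).support, y.1 ∈ Finsupp.supported R R (X ∪ a'.1.1) := by
    rintro ⟨⟨Y, q⟩, hq, hY⟩
    obtain ⟨Y₁, hY₁⟩ := hX.exists_finset_supported hreg Y
    obtain ⟨y₀, hy₀⟩ := (bijective_smul_of_isLocalization (Q := Q) S hq).2 1
    let Y₂ := insert y₀ (Y ∪ Y₁)
    obtain ⟨b, hb⟩ := IsLocalization.exist_integer_multiples_of_finset S Y₂
    refine ⟨⟨⟨Y₂, b * t * q * q⟩, ?_, fun y hy => ?_⟩, b * t * q, ?_, rfl, ⟨b, by ring⟩,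
      ⟨y₀, Finset.mem_insert_self _ _, hy₀⟩, ?_, ?_⟩
    · exact S.mul_mem (S.mul_mem (S.mul_mem b.2 ht) hq) hq
    · obtain ⟨r, hr⟩ := hb y hy
      refine ⟨t * q * q * r, ?_⟩
      rw [map_mul, hr]
      simp only [Algebra.smul_def, map_mul]
      ring
    · exact S.mul_mem (S.mul_mem b.2 ht) hq
    · exact Finset.subset_union_left.trans (Finset.subset_insert _ _)
    · intro p hp y hy
      refine Finsupp.supported_mono (Set.union_subset_union_right X ?_) (hY₁ p hp y hy)
      exact Finset.coe_subset.2 (Finset.subset_union_right.trans (Finset.subset_insert _ _))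
  choose next c hcS hc hdvd hinv hsub hrel using step
  let a : ℕ → A := Nat.rec ⟨⟨∅, 1⟩, S.one_mem, by simp⟩ (fun _ => next)
  exact ⟨fun n => (a n).1.1, fun n => (a n).1.2, fun n => c (a n), rfl, fun n => (a n).2.1,
    fun n => hcS _, fun n => hc _, fun n => hdvd _, fun n => hinv _, fun n => hsub _,
    fun n => hrel _, fun n => (a n).2.2⟩

/-- A partially defined map from a partial localization extends to every submodule obtained by
adjoining denominators successively. -/
theorem exists_linearPMap_tower {B : Submodule R Q} (hL : LiftsModulo S B) {D : Type}
    [AddCommGroup D] [Module R D] (hD : SDivisible R S D) (f : B →ₗ[R] D) {q c : ℕ → R}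
    (hq : q 0 = 1) (hcS : ∀ n, c n ∈ S) (hc : ∀ n, q (n + 1) = c n * q n) :
    ∃ f' : Q →ₗ.[R] D, (⟨B, f⟩ : Q →ₗ.[R] D) ≤ f' ∧
      ∀ z, z ∈ f'.domain ↔ ∃ n, q n • z ∈ B := by
  have step : ∀ n (F : B →ₗ[R] D), ∃ F' : B →ₗ[R] D, c n • F' = F := by
    intro n F
    obtain ⟨F', hF'⟩ := hL D D (LinearMap.lsmul R D (c n)) (hD _ (hcS n)) (c n) (hcS n)
      (fun x hx => hx) F
    exact ⟨F', hF'⟩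
  choose next hnext using step
  let F : ℕ → B →ₗ[R] D := Nat.rec f next
  have hF : ∀ n, c n • F (n + 1) = F n := fun n => hnext n (F n)
  let H : ℕ → Q →ₗ.[R] D := fun n => ⟨B.comap (LinearMap.lsmul R Q (q n)),
    F n ∘ₗ (LinearMap.lsmul R Q (q n)).restrict (fun _ hx => hx)⟩
  have hH : Monotone H := by
    refine monotone_nat_of_le_succ fun n => ⟨fun z hz => ?_, fun x y hxy => ?_⟩
    · change q (n + 1) • z ∈ B
      rw [hc, mul_smul]
      exact B.smul_mem _ hz
    · change F n ⟨q n • x.1, x.2⟩ = F (n + 1) ⟨q (n + 1) • y.1, y.2⟩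
      rw [← hF n, LinearMap.smul_apply, ← map_smul]
      congr 1
      refine Subtype.ext ?_
      change c n • q n • x.1 = q (n + 1) • y.1
      rw [hxy, hc, mul_smul]
  have hdir : DirectedOn (· ≤ ·) (Set.range H) := directedOn_range.2 hH.directed_le
  refine ⟨LinearPMap.sSup _ hdir, le_trans ⟨fun z hz => ?_, fun x y hxy => ?_⟩
    (LinearPMap.le_sSup hdir ⟨0, rfl⟩), fun z => ?_⟩
  · change q 0 • z ∈ B
    rwa [hq, one_smul]
  · change f x = f ⟨q 0 • y.1, y.2⟩
    congr 1
    refine Subtype.ext ?_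
    change x.1 = q 0 • y.1
    rw [hq, one_smul]
    exact hxy
  · rw [LinearPMap.mem_domain_sSup_iff (Set.range_nonempty H), Set.exists_range_iff]
    rfl

end Extension

section Maximal

variable {R Q : Type} [CommRing R] [CommRing Q] [Algebra R Q] {S : Submonoid R}

/-- A directed union is closed if the relations on each member are covered by another member. -/
theorem relClosed_iUnion
    {i : LinearMap.ker (freePresentation R Q) →ₗ[R] (LinearMap.ker (freePresentation R Q) →₀ R)}
    {ι : Type*} [Nonempty ι] {X : ι → Set Q} (hX : Directed (· ⊆ ·) X)
    (h : ∀ a, ∃ b, ∀ p : LinearMap.ker (freePresentation R Q),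
      p.1 ∈ Finsupp.supported R R (X a) →
        ∀ y ∈ (i p).support, y.1 ∈ Finsupp.supported R R (X b)) :
    RelClosed i (⋃ a, X a) := by
  intro p hp y hy
  obtain ⟨a, ha⟩ := hX.exists_mem_subset_of_finset_subset_biUnion hp
  obtain ⟨b, hb⟩ := h a
  exact Finsupp.supported_mono (Set.subset_iUnion X b) (hb p ha y hy)

theorem RelClosed.exists_extension [IsLocalization S Q] [IsNoetherianRing Q]
    (hreg : S ≤ nonZeroDivisors R)
    {i : LinearMap.ker (freePresentation R Q) →ₗ[R] (LinearMap.ker (freePresentation R Q) →₀ R)}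
    (hi : Finsupp.linearCombination R id ∘ₗ i = LinearMap.id)
    {X : Set Q} (hX : RelClosed i X) (hB : IsPartialLocalization S (Submodule.span R X)) {D : Type}
    [AddCommGroup D] [Module R D] (hD : SDivisible R S D) (f : Submodule.span R X →ₗ[R] D)
    {t : R} (ht : t ∈ S) :
    ∃ X' : Set Q, X ⊆ X' ∧ RelClosed i X' ∧ IsPartialLocalization S (Submodule.span R X') ∧
      (∃ v ∈ Submodule.span R X', t • v = 1) ∧
      ∃ f' : Q →ₗ.[R] D, (⟨Submodule.span R X, f⟩ : Q →ₗ.[R] D) ≤ f' ∧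
        f'.domain = Submodule.span R X' := by
  have hL : LiftsModulo S (Submodule.span R X) := hX.liftsModulo_span hi
  obtain ⟨Y, q, c, hq, hqS, hcS, hc, hdvd, hinv, hYsub, hrel, hY⟩ := hX.exists_tower hreg ht
  obtain ⟨f', hf, hf'⟩ := exists_linearPMap_tower hL hD f hq hcS hc
  have hYmono : Monotone Y := monotone_nat_of_le_succ hYsub
  have hmono : Monotone fun n => X ∪ (Y n : Set Q) := fun m n h =>
    Set.union_subset_union_right X (Finset.coe_subset.2 (hYmono h))
  have hqdvd : ∀ {m n}, m ≤ n → q m ∣ q n := fun {m n} h =>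
    Nat.le_induction dvd_rfl (fun n _ ih => ih.trans (by rw [hc]; exact Dvd.intro_left _ rfl)) n h
  have hup : ∀ {m n}, m ≤ n → ∀ {z}, q m • z ∈ Submodule.span R X →
      q n • z ∈ Submodule.span R X := by
    intro m n h z hz
    obtain ⟨d, hd⟩ := hqdvd h
    rw [hd, mul_comm, mul_smul]
    exact Submodule.smul_mem _ d hz
  have hR : ∀ r : R, algebraMap R Q r ∈ Submodule.span R X := fun r => by
    rw [Algebra.algebraMap_eq_smul_one]
    exact Submodule.smul_mem _ r hB.one_mem
  have hspan : ∀ z, z ∈ Submodule.span R (⋃ n, X ∪ (Y n : Set Q)) ↔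
      ∃ n, q n • z ∈ Submodule.span R X := by
    intro z
    refine ⟨fun hz => ?_, ?_⟩
    · rw [← hf']
      refine Submodule.span_le.2 (fun y hy => ?_) hz
      rw [SetLike.mem_coe, hf']
      obtain ⟨n, hy | hy⟩ := Set.mem_iUnion.1 hy
      · exact ⟨0, Submodule.smul_mem _ _ (Submodule.subset_span hy)⟩
      · obtain ⟨r, hr⟩ := hY n y hy
        exact ⟨n, hr ▸ hR r⟩
    · rintro ⟨n, hz⟩
      obtain ⟨r, b, hb, h⟩ := hB.exists_eq_algebraMap_add_smul hL (hqS n) hz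
      obtain ⟨y, hy, hqy⟩ := hinv n
      have hz' : z = r • y + b := by
        refine (bijective_smul_of_isLocalization (Q := Q) S (hqS n)).1 ?_
        change q n • z = q n • (r • y + b)
        rw [h, smul_add, smul_comm, hqy, Algebra.algebraMap_eq_smul_one]
      rw [hz']
      exact add_mem (Submodule.smul_mem _ r (Submodule.subset_span
        (Set.mem_iUnion.2 ⟨n + 1, Or.inr hy⟩)))
        (Submodule.span_mono (s := X) (fun x hx => Set.mem_iUnion.2 ⟨0, Or.inl hx⟩) hb)
  have hone : ∀ n z, q n • z = 1 → z ∈ Submodule.span R (⋃ n, X ∪ (Y n : Set Q)) :=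
    fun n z hz => (hspan z).2 ⟨n, by rw [hz]; exact hB.one_mem⟩
  refine ⟨⋃ n, X ∪ (Y n : Set Q), fun x hx => Set.mem_iUnion.2 ⟨0, Or.inl hx⟩,
    relClosed_iUnion hmono.directed_le fun n => ⟨n + 1, hrel n⟩, ⟨?_, ?_, ?_⟩, ?_, f', hf,
    Submodule.ext fun z => (hf' z).trans (hspan z).symm⟩
  · exact (hspan 1).2 ⟨0, Submodule.smul_mem _ _ hB.one_mem⟩
  · intro z hz w hw
    obtain ⟨m, hm⟩ := (hspan z).1 hz
    obtain ⟨n, hn⟩ := (hspan w).1 hw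
    have h1 := hB.mul_mem _ (hup (le_max_left m n) hm) _ (hup (le_max_right m n) hn)
    obtain ⟨d, hd⟩ := hdvd (max m n)
    refine (hspan _).2 ⟨max m n + 1, ?_⟩
    rw [smul_mul_smul_comm] at h1
    have h2 : q (max m n + 1) = (t * d * q (max m n)) * (q (max m n)) := by
      rw [hc, hd]
      ring
    have h3 : q (max m n + 1) = (t * d) * (q (max m n) * q (max m n)) := by
      rw [h2]
      ring
    rw [h3, mul_smul]
    exact Submodule.smul_mem _ _ h1
  · intro z hz
    obtain ⟨n, hn⟩ := (hspan z).1 hz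
    obtain ⟨u, hu, r, v, hv, hz, huv⟩ := hB.exists_den _ hn
    obtain ⟨y, hy, hqy⟩ := hinv n
    refine ⟨u * q n, S.mul_mem hu (hqS n), r, v * y, (hspan _).2 ⟨n, ?_⟩, ?_, ?_⟩
    · rwa [← mul_smul_comm, hqy, mul_one]
    · rw [mul_smul, hz]
    · rw [mul_smul, ← mul_smul_comm, hqy, mul_one, huv]
  · obtain ⟨d, hd⟩ := hdvd 0
    obtain ⟨v, hv⟩ := (bijective_smul_of_isLocalization (Q := Q) S ht).2 1
    have hv : t • v = 1 := hv
    refine ⟨v, (hspan v).2 ⟨1, ?_⟩, hv⟩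
    have h1 : q 1 = d * t := by
      rw [hc 0, hd, hq]
      ring
    rw [h1, mul_smul, hv]
    exact Submodule.smul_mem _ _ hB.one_mem

/-- A linear map on a partial localization, together with a relation-closed set of generators of
its domain. -/
structure IsPartialMap
    (i : LinearMap.ker (freePresentation R Q) →ₗ[R] (LinearMap.ker (freePresentation R Q) →₀ R))
    (S : Submonoid R) {D : Type} [AddCommGroup D] [Module R D] (e : Set Q × (Q →ₗ.[R] D)) :
    Prop where
  domain_eq : e.2.domain = Submodule.span R e.1
  relClosed : RelClosed i e.1
  isPartialLocalization : IsPartialLocalization S (Submodule.span R e.1)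

theorem IsPartialMap.exists_upperBound
    {i : LinearMap.ker (freePresentation R Q) →ₗ[R] (LinearMap.ker (freePresentation R Q) →₀ R)}
    {D : Type} [AddCommGroup D] [Module R D] {c : Set (Set Q × (Q →ₗ.[R] D))}
    (hcS : ∀ e ∈ c, IsPartialMap i S e) (hc : IsChain (· ≤ ·) c) (hne : c.Nonempty) :
    ∃ e, IsPartialMap i S e ∧ ∀ e' ∈ c, e' ≤ e := by
  have hdir : DirectedOn (· ≤ ·) (Prod.snd '' c) :=
    directedOn_image.2 fun a ha b hb =>
      (hc.directedOn a ha b hb).imp fun _ h => ⟨h.1, h.2.1.2, h.2.2.2⟩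
  have hle : ∀ a b : c, a.1 ≤ b.1 ∨ b.1 ≤ a.1 := fun a b => hc.total a.2 b.2
  have hX : Directed (· ⊆ ·) fun e : c => e.1.1 := fun a b =>
    (hle a b).elim (fun h => ⟨b, h.1, le_rfl⟩) (fun h => ⟨a, le_rfl, h.1⟩)
  have : Nonempty c := hne.to_subtype
  have hspan : ∀ z, z ∈ Submodule.span R (⋃ e : c, e.1.1) ↔
      ∃ e : c, z ∈ Submodule.span R e.1.1 := by
    intro z
    rw [Submodule.span_iUnion, Submodule.mem_iSup_of_directed]
    exact fun a b => (hX a b).imp fun e h => ⟨Submodule.span_mono h.1, Submodule.span_mono h.2⟩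
  refine ⟨⟨⋃ e : c, e.1.1, LinearPMap.sSup _ hdir⟩, ⟨?_, ?_, ?_, ?_, ?_⟩, fun e he =>
    ⟨Set.subset_iUnion (fun e : c => e.1.1) ⟨e, he⟩,
      LinearPMap.le_sSup hdir (Set.mem_image_of_mem _ he)⟩⟩
  · ext z
    rw [LinearPMap.mem_domain_sSup_iff (hne.image _), Set.exists_mem_image, hspan,
      Subtype.exists]
    exact exists_congr fun e => ⟨fun ⟨he, hz⟩ => ⟨he, (hcS e he).domain_eq ▸ hz⟩,
      fun ⟨he, hz⟩ => ⟨he, (hcS e he).domain_eq ▸ hz⟩⟩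
  · exact relClosed_iUnion hX fun e => ⟨e, (hcS e.1 e.2).relClosed⟩
  · exact (hspan 1).2 ⟨Classical.arbitrary c, (hcS _ (Classical.arbitrary c).2).3.one_mem⟩
  · intro z hz w hw
    obtain ⟨a, ha⟩ := (hspan z).1 hz
    obtain ⟨b, hb⟩ := (hspan w).1 hw
    obtain ⟨e, hae, hbe⟩ := hX a b
    exact (hspan _).2 ⟨e, (hcS e.1 e.2).isPartialLocalization.mul_mem _
      (Submodule.span_mono hae ha) _ (Submodule.span_mono hbe hb)⟩
  · intro z hz
    obtain ⟨e, he⟩ := (hspan z).1 hz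
    obtain ⟨u, hu, r, v, hv, h⟩ := (hcS e.1 e.2).isPartialLocalization.exists_den z he
    exact ⟨u, hu, r, v, (hspan v).2 ⟨e, hv⟩, h⟩

theorem exists_isPartialMap_apply_one [IsLocalization S Q] (hreg : S ≤ nonZeroDivisors R)
    (i : LinearMap.ker (freePresentation R Q) →ₗ[R] (LinearMap.ker (freePresentation R Q) →₀ R))
    {D : Type} [AddCommGroup D] [Module R D] (d : D) :
    ∃ e : Set Q × (Q →ₗ.[R] D), IsPartialMap i S e ∧
      ∃ h : 1 ∈ e.2.domain, e.2 ⟨1, h⟩ = d := by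
  have hinj : Function.Injective (algebraMap R Q) := IsLocalization.injective Q hreg
  have hzero : ∀ p ∈ LinearMap.ker (freePresentation R Q),
      p ∈ Finsupp.supported R R ({1} : Set Q) → p = 0 := by
    intro p hp hp1
    obtain ⟨r, rfl⟩ := Finsupp.support_subset_singleton'.1
      (Finset.coe_subset.1 (by rwa [Finset.coe_singleton]))
    rw [LinearMap.mem_ker, Finsupp.linearCombination_single, id_eq,
      ← Algebra.algebraMap_eq_smul_one, ← map_zero (algebraMap R Q)] at hp
    rw [hinj hp, Finsupp.single_zero]
  obtain ⟨f, hf⟩ := exists_linearMap_span (X := ({1} : Set Q)) (g := fun _ => d)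
    fun p hp hp1 => by rw [hzero p hp hp1, map_zero]
  have hone : (1 : Q) ∈ Submodule.span R {1} := Submodule.mem_span_singleton_self 1
  refine ⟨⟨{1}, _, f⟩, ⟨rfl, fun p hp y hy => ?_, hone, fun z hz w hw => ?_, fun z hz => ?_⟩,
    hone, hf 1 hone rfl⟩
  · have : p = 0 := Subtype.ext (hzero p.1 p.2 hp)
    rw [this, map_zero] at hy
    simp at hy
  · obtain ⟨r, rfl⟩ := Submodule.mem_span_singleton.1 hz
    rw [smul_one_mul]
    exact Submodule.smul_mem _ r hw
  · obtain ⟨r, rfl⟩ := Submodule.mem_span_singleton.1 hz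
    exact ⟨1, S.one_mem, r, 1, hone, by rw [one_smul, Algebra.algebraMap_eq_smul_one],
      one_smul R 1⟩

theorem exists_linearMap_apply_one_of_section [IsLocalization S Q] [IsNoetherianRing Q]
    (hreg : S ≤ nonZeroDivisors R)
    {i : LinearMap.ker (freePresentation R Q) →ₗ[R] (LinearMap.ker (freePresentation R Q) →₀ R)}
    (hi : Finsupp.linearCombination R id ∘ₗ i = LinearMap.id) {D : Type}
    [AddCommGroup D] [Module R D] (hD : SDivisible R S D) (d : D) :
    ∃ f : Q →ₗ[R] D, f 1 = d := by
  obtain ⟨e₀, he₀, h₁, hd⟩ := exists_isPartialMap_apply_one (S := S) hreg i d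
  obtain ⟨⟨X, ⟨A, f⟩⟩, hle, he, hmax⟩ := zorn_le_nonempty₀ {e | IsPartialMap i S e}
    (fun c hcS hc y hy => IsPartialMap.exists_upperBound hcS hc ⟨y, hy⟩) e₀ he₀
  obtain ⟨hA, hX, hB⟩ := he
  change A = Submodule.span R X at hA
  subst hA
  change RelClosed i X at hX
  change IsPartialLocalization S (Submodule.span R X) at hB
  have hinv : ∀ t ∈ S, ∃ v ∈ Submodule.span R X, t • v = 1 := by
    intro t ht
    obtain ⟨X', hXX', hX', hB', ⟨v, hv, htv⟩, f', hf, hf'⟩ := hX.exists_extension hreg hi hB hD f ht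
    have hm := hmax (y := ⟨X', f'⟩) ⟨hf', hX', hB'⟩ ⟨hXX', hf⟩
    exact ⟨v, Submodule.span_mono hm.1 hv, htv⟩
  have htop : ∀ z, z ∈ Submodule.span R X := by
    intro z
    obtain ⟨⟨r, s⟩, h⟩ := IsLocalization.surj S z
    obtain ⟨v, hv, hsv⟩ := hinv s s.2
    have hz : z = r • v := by
      refine (bijective_smul_of_isLocalization (Q := Q) S s.2).1 ?_
      change (s : R) • z = (s : R) • r • v
      rw [smul_comm, hsv, ← Algebra.algebraMap_eq_smul_one, ← h, Algebra.smul_def, mul_comm]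
    rw [hz]
    exact Submodule.smul_mem _ r hv
  refine ⟨f ∘ₗ LinearMap.id.codRestrict _ htop, ?_⟩
  rw [← hd]
  exact (hle.2.2 rfl).symm

end Maximal

section Main

variable {R : Type} [CommRing R] {S : Submonoid R}

theorem SMatlis.exists_linearMap_apply_one [IsNoetherianRing (Localization S)]
    (hreg : S ≤ nonZeroDivisors R) (h : SMatlis R S) (D : Type) [AddCommGroup D] [Module R D]
    (hD : SDivisible R S D) (d : D) : ∃ f : Localization S →ₗ[R] D, f 1 = d := by
  obtain ⟨P, _, _, f, _, hf, _⟩ := h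
  have := projective_ker_freePresentation hf
  obtain ⟨i, hi⟩ := Module.projective_lifting_property
    (Finsupp.linearCombination R (id : LinearMap.ker (freePresentation R (Localization S)) → _))
    LinearMap.id (Finsupp.linearCombination_id_surjective R _)
  exact exists_linearMap_apply_one_of_section hreg hi hD d

end Main

/-- Let `S` be a regular multiplicative subset of `R` with `R_S` semisimple. Then every
`S`-divisible `R`-module admits an `S`-strongly flat cover iff `R` is an `S`-Matlis ring. -/
theorem sDivisible_covers_iff_sMatlis (R : Type) [CommRing R] (S : Submonoid R)
    (hreg : S ≤ nonZeroDivisors R) [IsSemisimpleRing (Localization S)] :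
    (∀ (M : Type) [AddCommGroup M] [Module R M], SDivisible R S M →
      ∃ (F : Type) (_ : AddCommGroup F) (_ : Module R F) (f : F →ₗ[R] M),
        SStronglyFlat R S F ∧
        (∀ (G : Type) [AddCommGroup G] [Module R G], SStronglyFlat R S G →
          ∀ g : G →ₗ[R] M, ∃ g' : G →ₗ[R] F, f ∘ₗ g' = g) ∧
        (∀ h : F →ₗ[R] F, f ∘ₗ h = f → Function.Bijective h)) ↔
    SMatlis R S := by
  constructor
  · intro h
    refine sMatlis_of_exists_linearMap_apply_one hreg fun M _ _ hM m => ?_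
    obtain ⟨F, _, _, f, hF, hpre, hcov⟩ := h M hM
    exact exists_linearMap_apply_one_of_cover hM hF hpre hcov m
  · intro h M _ _ hM
    exact exists_cover_of_exists_linearMap_apply_one
      (fun D _ _ hD d => h.exists_linearMap_apply_one hreg D hD d) M hM
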